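/- arXiv:1511.04893 — 2 statements merged into one kernel-verified Lean document; each statement's English description precedes it below -/
import Mathlib

section
/- Let G = (N, C, P, S) be a ZCFGr and let H = (N, C ⊎ C̃, P', S) where C̃ = { c̃ : c ∈ C } is a disjoint copy of C and P' contains the production (a, R ∪ R̃, (z, −z), w) for every production (a, R, z, w) ∈ P. Then for all multisets s, t over N and all u, v ∈ ℤ^C: the configuration (t, (v, −v)) is coverable from (s, (u, −u)) in H if and only if (s, u) →* (t, v) in G. -/
open scoped Classical

/-- A production of a context-free commutative grammar with integer counters and
resets (ZCFGr): `(a_p, R_p, z_p, w_p)`. -/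
structure Production (N C : Type) where
  lhs : N
  resets : Set C
  update : C → ℤ
  rhs : Multiset N

/-- A configuration: a finite multiset over non-terminals together with a counter
valuation in `ℤ^C`. -/
abbrev Config (N C : Type) := Multiset N × (C → ℤ)

/-- `resetOn u R` is `u_{|R}`: it agrees with `u` outside `R` and is `0` on `R`. -/
noncomputable def resetOn {C : Type} (u : C → ℤ) (R : Set C) : C → ℤ :=
  fun c => if c ∈ R then 0 else u c

/-- Elementary step using the production `p`. -/
def StepP {N C : Type} (p : Production N C) : Config N C → Config N C → Prop :=
  fun cfg cfg' => ∃ w : Multiset N,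
    cfg.1 = w + {p.lhs} ∧ cfg'.1 = w + p.rhs ∧
    cfg'.2 = resetOn cfg.2 p.resets + p.update

/-- Elementary step using any production from `P`. -/
def Step {N C : Type} (P : Set (Production N C)) : Config N C → Config N C → Prop :=
  fun cfg cfg' => ∃ p ∈ P, StepP p cfg cfg'

/-- Reachability: reflexive-transitive closure of the step relation. -/
def Reach {N C : Type} (P : Set (Production N C)) : Config N C → Config N C → Prop :=
  Relation.ReflTransGen (Step P)

/-- The production `(a, R ∪ R̃, (z, -z), w)` over the doubled counter set `C ⊎ C̃`
obtained from a production `(a, R, z, w)` over `C`.  The left summand of `C ⊕ C`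
plays the role of `C` and the right summand the role of the disjoint copy `C̃`. -/
def liftProd {N C : Type} (p : Production N C) : Production N (C ⊕ C) :=
  { lhs := p.lhs
    resets := {x | ∃ c ∈ p.resets, x = Sum.inl c ∨ x = Sum.inr c}
    update := Sum.elim p.update (fun c => - p.update c)
    rhs := p.rhs }

/-- The doubled valuation `(u, -u)` over `C ⊕ C`. -/
def doubled {C : Type} (u : C → ℤ) : C ⊕ C → ℤ :=
  Sum.elim u (fun c => - u c)

theorem doubled_resetOn_add_update {N C : Type} (p : Production N C) (u : C → ℤ) :
    resetOn (doubled u) (liftProd p).resets + (liftProd p).update =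
      doubled (resetOn u p.resets + p.update) := by
  funext x
  rcases x with c | c <;> by_cases hc : c ∈ p.resets <;>
    simp [resetOn, doubled, liftProd, hc, add_comm]

theorem Step.lift_doubled {N C : Type} {P : Set (Production N C)} {a b : Config N C}
    (h : Step P a b) :
    Step (liftProd '' P) (a.1, doubled a.2) (b.1, doubled b.2) := by
  obtain ⟨p, hp, w, ha, hb, hu⟩ := h
  exact ⟨liftProd p, ⟨p, hp, rfl⟩, w, ha, hb, by
    simp only [hu, doubled_resetOn_add_update]⟩

theorem Step.exists_of_doubled {N C : Type} {P : Set (Production N C)} {a : Config N C}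
    {b : Config N (C ⊕ C)} (h : Step (liftProd '' P) (a.1, doubled a.2) b) :
    ∃ v, b.2 = doubled v ∧ Step P a (b.1, v) := by
  obtain ⟨_, ⟨p, hp, rfl⟩, w, ha, hb, hu⟩ := h
  exact ⟨resetOn a.2 p.resets + p.update, hu.trans (doubled_resetOn_add_update p a.2),
    p, hp, w, ha, hb, rfl⟩

theorem Reach.exists_of_doubled {N C : Type} {P : Set (Production N C)} {a : Config N C}
    {b : Config N (C ⊕ C)} (h : Reach (liftProd '' P) (a.1, doubled a.2) b) :
    ∃ v, b.2 = doubled v ∧ Reach P a (b.1, v) := by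
  induction h with
  | refl => exact ⟨a.2, rfl, Relation.ReflTransGen.refl⟩
  | @tail b c _ hbc ih =>
    obtain ⟨s, z⟩ := b
    obtain ⟨v, rfl, hv⟩ := ih
    obtain ⟨v', hc, hstep⟩ := Step.exists_of_doubled (a := (s, v)) hbc
    exact ⟨v', hc, hv.tail hstep⟩

theorem eq_of_doubled_le_doubled {C : Type} {v v' : C → ℤ}
    (h : ∀ x, doubled v x ≤ doubled v' x) : v = v' :=
  funext fun c => le_antisymm (h (Sum.inl c)) (neg_le_neg_iff.mp (h (Sum.inr c)))

/-- `(t, (v, -v))` is coverable from `(s, (u, -u))` in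
`H = (N, C ⊎ C̃, P', S)` iff `(s, u) →* (t, v)` in `G = (N, C, P, S)`. -/
theorem cover_doubled_iff_reach {N C : Type} [Fintype N] [Fintype C]
    (P : Set (Production N C)) (hP : P.Finite) (S : N)
    (s t : Multiset N) (u v : C → ℤ) :
    (∃ z : C ⊕ C → ℤ,
        (∀ x : C ⊕ C, Sum.elim v (fun c => - v c) x ≤ z x) ∧
        Reach (liftProd '' P) (s, Sum.elim u (fun c => - u c)) (t, z)) ↔
      Reach P (s, u) (t, v) := by
  constructor
  · rintro ⟨z, hz, h⟩
    obtain ⟨v', rfl, hv'⟩ := Reach.exists_of_doubled (a := (s, u)) h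
    rwa [eq_of_doubled_le_doubled hz]
  · intro h
    exact ⟨doubled v, fun _ => le_rfl,
      Relation.ReflTransGen.lift (fun a : Config N C => (a.1, doubled a.2))
        (fun _ _ => Step.lift_doubled) _ _ h⟩
end

section
/- Let r, s ≥ 1, let u₁, …, u_r ∈ ℕ, v₁, …, v_s ∈ ℕ, and t ∈ ℕ. Set h = (Σ_{j=1}^{r} u_j) + (Σ_{j=1}^{s} v_j) + 1 and assume t < h. Then the following are equivalent: (1) for every ε ∈ {0,1}^r there exists δ ∈ {0,1}^s such that Σ_{j=1}^{r} ε_j·u_j + Σ_{j=1}^{s} δ_j·v_j = t; (2) for every i ∈ ℕ with i < 2^r there exist ε ∈ {0,1}^r and δ ∈ {0,1}^s such that Σ_{j=1}^{r} ε_j·(u_j + 2^{j−1}·h) + Σ_{j=1}^{s} δ_j·v_j = t + i·h. -/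
/-- A `{0,1}`-valued natural-number vector as a vector with entries in `Fin 2`. -/
lemma exists_fin_two_of_le_one {r : ℕ} {ε : Fin r → ℕ} (hε : ∀ j, ε j ≤ 1) :
    ∃ f : Fin r → Fin 2, ∀ j, (f j : ℕ) = ε j :=
  ⟨fun j => ⟨ε j, Nat.lt_succ_of_le (hε j)⟩, fun _ => rfl⟩

lemma exists_binary_digits {r i : ℕ} (hi : i < 2 ^ r) :
    ∃ ε : Fin r → ℕ, (∀ j, ε j ≤ 1) ∧ ∑ j, ε j * 2 ^ (j : ℕ) = i := by
  refine ⟨fun j => (finFunctionFinEquiv.symm ⟨i, hi⟩ : Fin r → Fin 2) j, fun j => Fin.is_le _, ?_⟩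
  rw [← finFunctionFinEquiv_apply, Equiv.apply_symm_apply]

lemma sum_binary_digits_lt {r : ℕ} {ε : Fin r → ℕ} (hε : ∀ j, ε j ≤ 1) :
    ∑ j, ε j * 2 ^ (j : ℕ) < 2 ^ r := by
  obtain ⟨f, hf⟩ := exists_fin_two_of_le_one hε
  simp only [← hf, ← finFunctionFinEquiv_apply]
  exact Fin.is_lt _

lemma binary_digits_unique {r : ℕ} {ε ε' : Fin r → ℕ} (hε : ∀ j, ε j ≤ 1) (hε' : ∀ j, ε' j ≤ 1)
    (heq : ∑ j, ε j * 2 ^ (j : ℕ) = ∑ j, ε' j * 2 ^ (j : ℕ)) : ε = ε' := by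
  obtain ⟨f, hf⟩ := exists_fin_two_of_le_one hε
  obtain ⟨g, hg⟩ := exists_fin_two_of_le_one hε'
  simp only [← hf, ← hg, ← finFunctionFinEquiv_apply] at heq
  have hfg : f = g := finFunctionFinEquiv.injective (Fin.ext heq)
  funext j
  rw [← hf, ← hg, hfg]

lemma sum_mul_add_two_pow_mul {r : ℕ} (ε u : Fin r → ℕ) (h : ℕ) :
    ∑ j, ε j * (u j + 2 ^ (j : ℕ) * h) =
      ∑ j, ε j * u j + (∑ j, ε j * 2 ^ (j : ℕ)) * h := by
  rw [Finset.sum_mul, ← Finset.sum_add_distrib]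
  exact Finset.sum_congr rfl fun j _ => by ring

lemma sum_mul_le_sum_of_le_one {r : ℕ} {ε : Fin r → ℕ} (hε : ∀ j, ε j ≤ 1) (u : Fin r → ℕ) :
    ∑ j, ε j * u j ≤ ∑ j, u j :=
  Finset.sum_le_sum fun j _ => mul_le_of_le_one_left (Nat.zero_le _) (hε j)

/-- Quotient and remainder by `h` are determined by the number they represent. -/
lemma eq_and_eq_of_add_mul_eq {a b m n h : ℕ} (ha : a < h) (hb : b < h)
    (heq : a + m * h = b + n * h) : a = b ∧ m = n := by
  have hab : a = b := by
    simpa [Nat.mod_eq_of_lt ha, Nat.mod_eq_of_lt hb] using congrArg (· % h) heq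
  subst hab
  exact ⟨rfl, Nat.eq_of_mul_eq_mul_right (by omega) (Nat.add_left_cancel heq)⟩

/-- correctness of the reduction from Π₂-Subset Sum to
Simultaneous Subset Sum.  With `h = Σu + Σv + 1` and `t < h`, the Π₂-Subset Sum
condition for `(u, v, t)` holds iff the Simultaneous Subset Sum condition holds
for the numbers `u_j + 2^{j-1}·h` (0-based: `u_j + 2^j·h`) and `v_j`, step `h`,
exponent `r` and target `t`. -/
theorem pi2_subset_sum_iff_simultaneous {r s : ℕ} (hr : 1 ≤ r) (hs : 1 ≤ s)
    (u : Fin r → ℕ) (v : Fin s → ℕ) (t h : ℕ)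
    (hh : h = (∑ j, u j) + (∑ j, v j) + 1) (ht : t < h) :
    (∀ ε : Fin r → ℕ, (∀ j, ε j ≤ 1) →
        ∃ δ : Fin s → ℕ, (∀ j, δ j ≤ 1) ∧
          (∑ j, ε j * u j) + (∑ j, δ j * v j) = t) ↔
    (∀ i : ℕ, i < 2 ^ r →
        ∃ (ε : Fin r → ℕ) (δ : Fin s → ℕ),
          (∀ j, ε j ≤ 1) ∧ (∀ j, δ j ≤ 1) ∧
          (∑ j, ε j * (u j + 2 ^ (j : ℕ) * h)) + (∑ j, δ j * v j) = t + i * h) := by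
  constructor
  · intro H i hi
    obtain ⟨ε, hε, rfl⟩ := exists_binary_digits hi
    obtain ⟨δ, hδ, hsum⟩ := H ε hε
    refine ⟨ε, δ, hε, hδ, ?_⟩
    rw [sum_mul_add_two_pow_mul, ← hsum]
    ring
  · intro H ε hε
    obtain ⟨ε', δ, hε', hδ, hsum⟩ := H _ (sum_binary_digits_lt hε)
    rw [sum_mul_add_two_pow_mul, add_right_comm] at hsum
    have hu := sum_mul_le_sum_of_le_one hε' u
    have hv := sum_mul_le_sum_of_le_one hδ v
    obtain ⟨hlow, hhigh⟩ := eq_and_eq_of_add_mul_eq (by omega) ht hsum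
    obtain rfl := binary_digits_unique hε' hε hhigh
    exact ⟨δ, hδ, hlow⟩
end
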